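/- Let w be any solution of equation (E) defined on an interval [r₀,∞) with r₀ > 0. Then lim_{r→∞} w(r) = 0 and lim_{r→∞} w'(r) = 0. Moreover, if w(r) > 0 for all sufficiently large r, then w'(r) < 0 for all sufficiently large r. -/

import Mathlib

open Set Filter Topology Asymptotics

/-- The p-Laplacian nonlinearity φ_p(x) = |x|^{p-2} x. -/
noncomputable def phiP (p x : ℝ) : ℝ := |x| ^ (p - 2) * x

/-- `w` is a solution of equation (E) on the interval `I ⊆ (0,∞)`:
`w` is C¹ on `I`, `|w'|^{p-2} w'` is C¹ on `I`, and the equation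
`(|w'|^{p-2}w')' + ((N-1)/r)|w'|^{p-2}w' + r w' + α w + |w|^{q-1} w = 0`
holds on `I` (derivatives taken within `I`). -/
def IsSolutionOn (N : ℕ) (p q α : ℝ) (w : ℝ → ℝ) (I : Set ℝ) : Prop :=
  ContDiffOn ℝ 1 w I ∧
  ContDiffOn ℝ 1 (fun r => phiP p (derivWithin w I r)) I ∧
  ∀ r ∈ I,
    derivWithin (fun s => phiP p (derivWithin w I s)) I r
      + ((N : ℝ) - 1) / r * phiP p (derivWithin w I r)
      + r * derivWithin w I r + α * w r + |w r| ^ (q - 1) * w r = 0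

/-- `w` is the global solution of (E) on `[0,∞)` with `w(0) = a`, `w'(0) = 0`:
`w ∈ C¹([0,∞))`, `|w'|^{p-2}w' ∈ C¹([0,∞))`, and (E) holds on `(0,∞)`. -/
def IsGlobalSolution (N : ℕ) (p q α a : ℝ) (w : ℝ → ℝ) : Prop :=
  ContDiffOn ℝ 1 w (Ici 0) ∧
  ContDiffOn ℝ 1 (fun r => phiP p (derivWithin w (Ici 0) r)) (Ici 0) ∧
  (∀ r ∈ Ioi (0 : ℝ),
    derivWithin (fun s => phiP p (derivWithin w (Ici 0) s)) (Ici 0) r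
      + ((N : ℝ) - 1) / r * phiP p (derivWithin w (Ici 0) r)
      + r * derivWithin w (Ici 0) r + α * w r + |w r| ^ (q - 1) * w r = 0) ∧
  w 0 = a ∧ derivWithin w (Ici 0) 0 = 0

/-- `r` is an isolated zero of `w` relative to the set `I`. -/
def IsIsolatedZeroOn (w : ℝ → ℝ) (I : Set ℝ) (r : ℝ) : Prop :=
  r ∈ I ∧ w r = 0 ∧ ∀ᶠ s in 𝓝[I \ {r}] r, w s ≠ 0

/-- `w` has at least `n` isolated zeros in `(0,∞)`. -/
def HasAtLeastIsolatedZeros (w : ℝ → ℝ) (n : ℕ) : Prop :=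
  ∃ z : Fin n → ℝ, StrictMono z ∧ ∀ i, 0 < z i ∧ IsIsolatedZeroOn w (Ici 0) (z i)

/-- `w` has derivative `u` and `φ_p(u)' = -((n/r) φ_p(u) + r u + α w + |w|^{q-1} w)` on `(a,∞)`. -/
structure IsDecaySystem (n p q α a : ℝ) (w u : ℝ → ℝ) : Prop where
  hasDerivAt_fst : ∀ r, a < r → HasDerivAt w (u r) r
  hasDerivAt_flux : ∀ r, a < r → HasDerivAt (fun s => phiP p (u s))
    (-(n / r * phiP p (u r) + r * u r + (α * w r + |w r| ^ (q - 1) * w r))) r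

section PhiP

lemma phiP_neg (p x : ℝ) : phiP p (-x) = -phiP p x := by
  simp [phiP]

lemma phiP_zero (p : ℝ) : phiP p 0 = 0 := by
  simp [phiP]

lemma mul_phiP_nonneg (p x : ℝ) : 0 ≤ phiP p x * x := by
  have : phiP p x * x = |x| ^ (p - 2) * (x * x) := by unfold phiP; ring
  rw [this]
  exact mul_nonneg (by positivity) (mul_self_nonneg x)

lemma abs_phiP {p : ℝ} (hp : 1 < p) (x : ℝ) : |phiP p x| = |x| ^ (p - 1) := by
  rcases eq_or_ne x 0 with rfl | hx
  · rw [phiP_zero, abs_zero, Real.zero_rpow (by linarith)]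
  · have hx' : 0 < |x| := abs_pos.2 hx
    rw [phiP, abs_mul, abs_of_nonneg (by positivity), show p - 1 = (p - 2) + 1 by ring,
      Real.rpow_add_one hx'.ne']

lemma abs_phiP_rpow_inv {p : ℝ} (hp : 1 < p) (x : ℝ) : |phiP p x| ^ (p - 1)⁻¹ = |x| := by
  rw [abs_phiP hp, Real.rpow_rpow_inv (abs_nonneg x) (by linarith)]

lemma phiP_conj_phiP {p : ℝ} (hp : 1 < p) (x : ℝ) : phiP (p / (p - 1)) (phiP p x) = x := by
  rcases eq_or_ne x 0 with rfl | hx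
  · rw [phiP_zero, phiP_zero]
  · have hx' : 0 < |x| := abs_pos.2 hx
    have hp1 : p - 1 ≠ 0 := by linarith
    rw [phiP, abs_phiP hp, ← Real.rpow_mul hx'.le, phiP, ← mul_assoc, ← Real.rpow_add hx',
      show (p - 1) * (p / (p - 1) - 2) + (p - 2) = 0 by field_simp; ring, Real.rpow_zero, one_mul]

lemma pos_of_phiP_pos {p x : ℝ} (h : 0 < phiP p x) : 0 < x :=
  pos_of_mul_pos_right h (by positivity)

lemma neg_of_phiP_neg {p x : ℝ} (h : phiP p x < 0) : x < 0 := by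
  by_contra! hx
  exact absurd h (not_lt.2 (mul_nonneg (by positivity) hx))

lemma phiP_eq_zero {p x : ℝ} (hp : 1 < p) : phiP p x = 0 → x = 0 := by
  intro h
  have := phiP_conj_phiP hp x
  rwa [h, phiP_zero, eq_comm] at this

end PhiP

section RealFunctions

lemma antitoneOn_Ioi_of_hasDerivAt_nonpos {f f' : ℝ → ℝ} {a : ℝ}
    (hf : ∀ r, a < r → HasDerivAt f (f' r) r) (hf' : ∀ r, a < r → f' r ≤ 0) :
    AntitoneOn f (Ioi a) := by
  refine antitoneOn_of_deriv_nonpos (convex_Ioi a)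
    (fun r hr => (hf r hr).continuousAt.continuousWithinAt) ?_ ?_
  · rw [interior_Ioi]
    exact fun r hr => (hf r hr).differentiableAt.differentiableWithinAt
  · rw [interior_Ioi]
    intro r hr
    rw [(hf r hr).deriv]
    exact hf' r hr

lemma AntitoneOn.exists_tendsto_atTop {f : ℝ → ℝ} {a c : ℝ} (hf : AntitoneOn f (Ioi a))
    (hc : ∀ r, a < r → c ≤ f r) : ∃ l, Tendsto f atTop (𝓝 l) := by
  have hmem : ∀ r, a < max r (a + 1) := fun r => lt_max_of_lt_right (lt_add_one a)
  have hanti : Antitone fun r => f (max r (a + 1)) := fun r s hrs =>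
    hf (hmem r) (hmem s) (max_le_max_right _ hrs)
  refine ⟨_, (tendsto_atTop_ciInf hanti ⟨c, ?_⟩).congr' ?_⟩
  · rintro _ ⟨r, rfl⟩
    exact hc _ (hmem r)
  · filter_upwards [eventually_ge_atTop (a + 1)] with r hr
    rw [max_eq_left hr]

lemma false_of_hasDerivAt_le_neg_div {f f' : ℝ → ℝ} {c M : ℝ} (hc : 0 < c)
    (hf : ∀ᶠ r in atTop, HasDerivAt f (f' r) r) (hf' : ∀ᶠ r in atTop, f' r ≤ -(c / r))
    (hM : ∀ᶠ r in atTop, M ≤ f r) : False := by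
  obtain ⟨a, ha⟩ := eventually_atTop.1 (hf.and (hf'.and (eventually_gt_atTop (0 : ℝ))))
  have hanti : AntitoneOn (fun r => f r + c * Real.log r) (Ioi a) := by
    refine antitoneOn_Ioi_of_hasDerivAt_nonpos (f' := fun r => f' r + c * r⁻¹)
      (fun r hr => ?_) fun r hr => ?_
    · obtain ⟨h1, -, h3⟩ := ha r hr.le
      exact h1.add ((Real.hasDerivAt_log h3.ne').const_mul c)
    · have := (ha r hr.le).2.1
      rw [div_eq_mul_inv] at this
      linarith
  have htop : Tendsto (fun r => M + c * Real.log r) atTop atTop :=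
    tendsto_atTop_add_const_left _ _ (Real.tendsto_log_atTop.const_mul_atTop hc)
  obtain ⟨r, h1, h2, h3⟩ := ((htop.eventually_gt_atTop
    (f (a + 1) + c * Real.log (a + 1))).and (hM.and (eventually_ge_atTop (a + 1)))).exists
  have := hanti (show a + 1 ∈ Ioi a from lt_add_one a)
    (show r ∈ Ioi a from (lt_add_one a).trans_le h3) h3
  simp only at this
  linarith

end RealFunctions

namespace IsDecaySystem

variable {n p q α a : ℝ} {w u : ℝ → ℝ}

lemma neg (h : IsDecaySystem n p q α a w u) :
    IsDecaySystem n p q α a (fun r => -w r) (fun r => -u r) where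
  hasDerivAt_fst r hr := (h.hasDerivAt_fst r hr).neg
  hasDerivAt_flux r hr := by
    simp only [phiP_neg, abs_neg]
    exact (h.hasDerivAt_flux r hr).neg.congr_deriv (by ring)

/-- The energy `|w'|^p / p' + α w² / 2 + |w|^{q+1} / (q+1)`, in terms of the flux `φ_p(w')`. -/
noncomputable def energy (p q α : ℝ) (w u : ℝ → ℝ) (r : ℝ) : ℝ :=
  |phiP p (u r)| ^ (p / (p - 1)) / (p / (p - 1)) + (α * w r ^ 2 / 2 + |w r| ^ (q + 1) / (q + 1))

lemma hasDerivAt_energy (h : IsDecaySystem n p q α a w u) (hp : 1 < p) (hq : 1 < q) {r : ℝ}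
    (hr : a < r) : HasDerivAt (energy p q α w u)
      (-(n / r * (phiP p (u r) * u r) + r * u r ^ 2)) r := by
  have hp' : 1 < p / (p - 1) := by rw [lt_div_iff₀] <;> linarith
  have h1 := (((hasDerivAt_abs_rpow (phiP p (u r)) hp').comp r
    (h.hasDerivAt_flux r hr)).div_const (p / (p - 1)))
  have h2 := (((h.hasDerivAt_fst r hr).pow 2).const_mul α).div_const 2
  have h3 := ((hasDerivAt_abs_rpow (w r) (by linarith : 1 < q + 1)).comp r
    (h.hasDerivAt_fst r hr)).div_const (q + 1)
  have hu := phiP_conj_phiP hp (u r)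
  rw [phiP] at hu
  have hq1 : q + 1 ≠ 0 := by linarith
  have hp0 : p / (p - 1) ≠ 0 := by linarith
  refine (h1.add (h2.add h3)).congr_deriv ?_
  rw [mul_assoc (p / (p - 1)), hu, show q + 1 - 2 = q - 1 by ring, mul_assoc (p / (p - 1)),
    mul_div_cancel_left₀ _ hp0, mul_assoc (q + 1), mul_assoc (q + 1),
    mul_div_cancel_left₀ _ hq1]
  push_cast
  ring

lemma energy_nonneg (hp : 1 < p) (hq : 1 < q) (hα : 0 < α) (r : ℝ) :
    0 ≤ energy p q α w u r := by
  have : 0 < p - 1 := by linarith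
  unfold energy
  positivity

lemma antitoneOn_energy (h : IsDecaySystem n p q α a w u) (hn : 0 ≤ n) (hp : 1 < p) (hq : 1 < q)
    (ha : 0 ≤ a) : AntitoneOn (energy p q α w u) (Ioi a) := by
  refine antitoneOn_Ioi_of_hasDerivAt_nonpos (fun r hr => h.hasDerivAt_energy hp hq hr)
    fun r hr => ?_
  have hr0 : 0 < r := ha.trans_lt hr
  have := mul_phiP_nonneg p (u r)
  rw [neg_nonpos]
  positivity

lemma exists_bounds (h : IsDecaySystem n p q α a w u) (hn : 0 ≤ n) (hp : 1 < p) (hq : 1 < q)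
    (hα : 0 < α) (ha : 0 ≤ a) : ∃ V W : ℝ, 0 ≤ V ∧ 0 ≤ W ∧
      ∀ r, a + 1 ≤ r → |phiP p (u r)| ≤ V ∧ |w r| ≤ W := by
  have hp1 : 0 < p - 1 := by linarith
  have hp' : 0 < p / (p - 1) := by positivity
  set M := energy p q α w u (a + 1) with hM
  have hM0 : 0 ≤ M := energy_nonneg hp hq hα _
  refine ⟨(M * (p / (p - 1))) ^ (p / (p - 1))⁻¹, √(2 * M / α), by positivity, by positivity,
    fun r hr => ?_⟩
  have hE : energy p q α w u r ≤ M := h.antitoneOn_energy hn hp hq ha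
    (show a + 1 ∈ Ioi a from lt_add_one a) (show r ∈ Ioi a from (lt_add_one a).trans_le hr) hr
  have h1 : 0 ≤ |phiP p (u r)| ^ (p / (p - 1)) / (p / (p - 1)) := by positivity
  have h2 : 0 ≤ α * w r ^ 2 / 2 := by positivity
  have h3 : 0 ≤ |w r| ^ (q + 1) / (q + 1) := by positivity
  rw [energy] at hE
  constructor
  · rw [Real.le_rpow_inv_iff_of_pos (abs_nonneg _) (by positivity) hp', ← div_le_iff₀ hp']
    linarith
  · apply Real.abs_le_sqrt
    rw [le_div_iff₀ hα]
    linarith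

lemma tendsto_snd (h : IsDecaySystem n p q α a w u) (hn : 0 ≤ n) (hp : 1 < p) (hq : 1 < q)
    (hα : 0 < α) (ha : 0 ≤ a) : Tendsto u atTop (𝓝 0) := by
  have hp1 : 0 < p - 1 := by linarith
  obtain ⟨V, W, hV, hW, hVW⟩ := h.exists_bounds hn hp hq hα ha
  set m : ℝ := 1 + 2 / (p - 1) with hm
  have hm1 : 1 < m := by
    have : 0 < 2 / (p - 1) := by positivity
    linarith
  have hsq : ∀ x, |phiP p x| ^ (m - 1) = x ^ 2 := fun x => by
    rw [abs_phiP hp, ← Real.rpow_mul (abs_nonneg x),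
      show (p - 1) * (m - 1) = (2 : ℕ) by rw [hm]; push_cast; field_simp; ring,
      Real.rpow_natCast, sq_abs]
  set K : ℝ := n * V + V ^ (p - 1)⁻¹ + W * (α + W ^ (q - 1)) with hK
  have hK0 : 0 ≤ K := by positivity
  have hflux : ∀ r, a + 1 < r →
      |-(n / r * phiP p (u r) + r * u r + (α * w r + |w r| ^ (q - 1) * w r))| ≤ K * r := by
    intro r hr
    obtain ⟨hv, hw⟩ := hVW r hr.le
    have hr1 : 1 ≤ r := by linarith
    have hu : |u r| ≤ V ^ (p - 1)⁻¹ := by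
      rw [← abs_phiP_rpow_inv hp (u r)]
      gcongr
    have h1 : |n / r * phiP p (u r)| ≤ n * V * r := by
      rw [abs_mul, abs_of_nonneg (by positivity)]
      have : n / r ≤ n * r := by
        rw [div_le_iff₀ (by linarith)]
        nlinarith [mul_nonneg hn (by nlinarith : 0 ≤ r * r - 1)]
      calc n / r * |phiP p (u r)| ≤ n * r * V := by gcongr
        _ = n * V * r := by ring
    have h2 : |r * u r| ≤ V ^ (p - 1)⁻¹ * r := by
      rw [abs_mul, abs_of_nonneg (by linarith), mul_comm]
      gcongr
    have h3 : |α * w r + |w r| ^ (q - 1) * w r| ≤ W * (α + W ^ (q - 1)) * r := by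
      rw [← add_mul, abs_mul, abs_of_nonneg (by positivity), mul_comm]
      have h4 : |w r| ^ (q - 1) ≤ W ^ (q - 1) := by gcongr
      calc |w r| * (α + |w r| ^ (q - 1)) ≤ W * (α + W ^ (q - 1)) := by gcongr
        _ ≤ W * (α + W ^ (q - 1)) * r := le_mul_of_one_le_right (by positivity) hr1
    rw [abs_neg]
    refine (abs_add_three _ _ _).trans ?_
    rw [hK]
    linarith
  obtain ⟨l, hl⟩ : ∃ l, Tendsto (fun r => |phiP p (u r)| ^ m + m * K * energy p q α w u r)
      atTop (𝓝 l) := by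
    refine AntitoneOn.exists_tendsto_atTop (a := a + 1) (c := 0)
      (antitoneOn_Ioi_of_hasDerivAt_nonpos (fun r hr =>
        ((hasDerivAt_abs_rpow (phiP p (u r)) hm1).comp r (h.hasDerivAt_flux r (by linarith))).add
          ((h.hasDerivAt_energy hp hq (by linarith)).const_mul (m * K))) fun r hr => ?_)
      fun r _ => ?_
    · have hr0 : 0 < r := by linarith
      have hdis : 0 ≤ n / r * (phiP p (u r) * u r) :=
        mul_nonneg (by positivity) (mul_phiP_nonneg p (u r))
      have habs : |m * |phiP p (u r)| ^ (m - 2) * phiP p (u r)| = m * u r ^ 2 := by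
        have := abs_phiP hm1 (phiP p (u r))
        rw [hsq, phiP] at this
        rw [mul_assoc, abs_mul, this, abs_of_pos (by linarith)]
      have hle := le_abs_self (m * |phiP p (u r)| ^ (m - 2) * phiP p (u r) *
        -(n / r * phiP p (u r) + r * u r + (α * w r + |w r| ^ (q - 1) * w r)))
      rw [abs_mul, habs] at hle
      have h1 := mul_le_mul_of_nonneg_left (hflux r hr)
        (by positivity : 0 ≤ m * u r ^ 2)
      have h2 : 0 ≤ m * K * (n / r * (phiP p (u r) * u r)) := by positivity
      linarith
    · have := energy_nonneg (w := w) (u := u) hp hq hα r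
      positivity
  obtain ⟨e, he⟩ := (h.antitoneOn_energy hn hp hq ha).exists_tendsto_atTop
    fun r _ => energy_nonneg hp hq hα r
  have hL : Tendsto (fun r => |phiP p (u r)| ^ m) atTop (𝓝 (l - m * K * e)) :=
    (hl.sub (he.const_mul (m * K))).congr fun r => by ring
  set L := l - m * K * e
  have hL0 : 0 ≤ L := ge_of_tendsto' hL fun r => by positivity
  have hLz : L = 0 := by
    by_contra hne
    have hLpos : 0 < L := lt_of_le_of_ne hL0 (Ne.symm hne)
    have hexp : ∀ r, u r ^ 2 = (|phiP p (u r)| ^ m) ^ ((m - 1) / m) := fun r => by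
      rw [← Real.rpow_mul (abs_nonneg _), mul_div_cancel₀ _ (by linarith), hsq]
    refine false_of_hasDerivAt_le_neg_div (f := energy p q α w u)
      (c := (L / 2) ^ ((m - 1) / m)) (M := 0) (by positivity)
      ((eventually_gt_atTop a).mono fun r hr => h.hasDerivAt_energy hp hq hr) ?_
      (Eventually.of_forall fun r => energy_nonneg hp hq hα r)
    filter_upwards [hL.eventually_const_lt (half_lt_self hLpos), eventually_gt_atTop 1]
      with r hr hr1
    have hdis : 0 ≤ n / r * (phiP p (u r) * u r) :=
      mul_nonneg (by positivity) (mul_phiP_nonneg p (u r))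
    have hc : (L / 2) ^ ((m - 1) / m) ≤ u r ^ 2 := by
      rw [hexp]
      have : 0 ≤ (m - 1) / m := div_nonneg (by linarith) (by linarith)
      gcongr
    have h1 : (L / 2) ^ ((m - 1) / m) / r ≤ u r ^ 2 :=
      (div_le_self (by positivity) hr1.le).trans hc
    nlinarith [mul_nonneg (sub_nonneg.2 hr1.le) (sq_nonneg (u r))]
  rw [hLz] at hL
  rw [tendsto_zero_iff_abs_tendsto_zero]
  have hs : 0 < (m * (p - 1))⁻¹ := by positivity
  have := hL.rpow_const (p := (m * (p - 1))⁻¹) (Or.inr hs.le)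
  rw [Real.zero_rpow hs.ne'] at this
  refine this.congr fun r => ?_
  rw [abs_phiP hp, ← Real.rpow_mul (abs_nonneg _), ← Real.rpow_mul (abs_nonneg _),
    mul_comm m (p - 1), mul_inv_cancel₀ (by positivity), Real.rpow_one,
    Function.comp_apply]

lemma not_eventually_ge (h : IsDecaySystem n p q α a w u) (hn : 0 ≤ n) (hp : 1 < p) (hq : 1 < q)
    (hα : 0 < α) (ha : 0 ≤ a) {δ : ℝ} (hδ : 0 < δ) : ¬ ∀ᶠ r in atTop, δ ≤ w r := by
  intro hw
  obtain ⟨V, W, hV, hW, hVW⟩ := h.exists_bounds hn hp hq hα ha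
  refine false_of_hasDerivAt_le_neg_div (f := fun r => phiP p (u r) / r + w r)
    (c := α * δ / 2) (M := -V + -W) (by positivity)
    (((eventually_gt_atTop a).and (eventually_gt_atTop 0)).mono fun r hr =>
      ((h.hasDerivAt_flux r hr.1).div (hasDerivAt_id r) hr.2.ne').add
        (h.hasDerivAt_fst r hr.1)) ?_ ?_
  · filter_upwards [hw, eventually_ge_atTop (a + 1), eventually_gt_atTop 0,
      eventually_ge_atTop ((n + 1) * V / (α * δ / 2))] with r hr hra hr0 hrV
    have hv := (abs_le.1 (hVW r hra).1).1
    rw [div_le_iff₀ (by positivity)] at hrV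
    have hw0 : 0 ≤ w r := by linarith
    have h1 : α * δ ≤ α * w r + |w r| ^ (q - 1) * w r :=
      (mul_le_mul_of_nonneg_left hr hα.le).trans (le_add_of_nonneg_right (by positivity))
    have h2 : (n + 1) * -V ≤ (n + 1) * phiP p (u r) := by gcongr
    have h3 := mul_le_mul_of_nonneg_left h1 hr0.le
    simp only [id]
    rw [← sub_nonneg]
    have : -(α * δ / 2 / r) - ((-(n / r * phiP p (u r) + r * u r +
        (α * w r + |w r| ^ (q - 1) * w r)) * r - phiP p (u r) * 1) / r ^ 2 + u r) =
        (r * (α * w r + |w r| ^ (q - 1) * w r) + (n + 1) * phiP p (u r)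
          - r * (α * δ / 2)) / r ^ 2 := by
      field_simp
      ring
    rw [this]
    exact div_nonneg (by linarith) (by positivity)
  · filter_upwards [eventually_ge_atTop (a + 1), eventually_ge_atTop 1] with r hra hr1
    obtain ⟨hv, hw⟩ := hVW r hra
    have h1 : |phiP p (u r) / r| ≤ V := by
      rw [abs_div]
      exact (div_le_self (abs_nonneg _) (hr1.trans (le_abs_self r))).trans hv
    exact add_le_add (abs_le.1 h1).1 (abs_le.1 hw).1

lemma tendsto_fst (h : IsDecaySystem n p q α a w u) (hn : 0 ≤ n) (hp : 1 < p) (hq : 1 < q)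
    (hα : 0 < α) (ha : 0 ≤ a) : Tendsto w atTop (𝓝 0) := by
  have hp1 : 0 < p - 1 := by linarith
  have hp' : 0 < p / (p - 1) := by positivity
  obtain ⟨L, he⟩ := (h.antitoneOn_energy hn hp hq ha).exists_tendsto_atTop
    fun r _ => energy_nonneg hp hq hα r
  have hkin : Tendsto (fun r => |phiP p (u r)| ^ (p / (p - 1)) / (p / (p - 1))) atTop (𝓝 0) := by
    have := ((h.tendsto_snd hn hp hq hα ha).abs.rpow_const (p := p) (Or.inr (by linarith)))
    rw [abs_zero, Real.zero_rpow (by linarith)] at this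
    rw [← zero_div (p / (p - 1))]
    refine (this.div_const _).congr fun r => ?_
    rw [abs_phiP hp, ← Real.rpow_mul (abs_nonneg _), mul_div_cancel₀ _ hp1.ne']
  set G : ℝ → ℝ := fun x => α * x ^ 2 / 2 + |x| ^ (q + 1) / (q + 1) with hG
  have hGw : Tendsto (fun r => G (w r)) atTop (𝓝 L) := by
    rw [← sub_zero L]
    refine (he.sub hkin).congr fun r => ?_
    simp only [energy, hG]
    ring
  have hGge : ∀ x, α * x ^ 2 / 2 ≤ G x := fun x => le_add_of_nonneg_right (by positivity)
  have hL0 : 0 ≤ L := ge_of_tendsto' hGw fun r => (by positivity : 0 ≤ α * w r ^ 2 / 2).trans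
    (hGge _)
  rcases hL0.eq_or_lt with rfl | hL
  · have hsq : Tendsto (fun r => w r ^ 2) atTop (𝓝 0) := by
      refine squeeze_zero (g := fun r => 2 / α * G (w r)) (fun r => sq_nonneg _) (fun r => ?_) ?_
      · have := mul_le_mul_of_nonneg_left (hGge (w r)) (by positivity : 0 ≤ 2 / α)
        calc w r ^ 2 = 2 / α * (α * w r ^ 2 / 2) := by field_simp
          _ ≤ _ := this
      · simpa using hGw.const_mul (2 / α)
    rw [tendsto_zero_iff_abs_tendsto_zero]
    simpa [Real.sqrt_sq_eq_abs, Function.comp_def] using hsq.sqrt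
  · exfalso
    have hGc : ContinuousAt G 0 := by
      refine ContinuousAt.add (by fun_prop) ((ContinuousAt.rpow_const (by fun_prop)
        (Or.inr (by linarith))).div_const _)
    have hG0 : G 0 = 0 := by
      simp only [hG, abs_zero]
      rw [Real.zero_rpow (by linarith)]
      simp
    have hev : ∀ᶠ x in 𝓝 0, G x < L / 2 := hGc.eventually_lt_const (by rw [hG0]; linarith)
    obtain ⟨δ, hδ, hball⟩ := Metric.eventually_nhds_iff.1 hev
    have habs : ∀ᶠ r in atTop, δ ≤ |w r| := by
      filter_upwards [hGw.eventually_const_lt (half_lt_self hL)] with r hr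
      by_contra! hlt
      exact absurd (hball (by simpa using hlt)) (not_lt.2 hr.le)
    obtain ⟨b, hb⟩ := eventually_atTop.1 (habs.and (eventually_gt_atTop a))
    have hcont : ContinuousOn w (Ici b) := fun r hr =>
      (h.hasDerivAt_fst r (hb r hr).2).continuousAt.continuousWithinAt
    have hne : ∀ r ∈ Ici b, w r ≠ 0 := fun r hr h0 => by
      have := (hb r hr).1
      rw [h0, abs_zero] at this
      linarith
    have hsign : (∀ r ∈ Ici b, 0 < w r) ∨ ∀ r ∈ Ici b, w r < 0 := by
      by_contra! hcon
      obtain ⟨⟨r, hr, hwr⟩, s, hs, hws⟩ := hcon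
      obtain ⟨t, ht, ht0⟩ := isPreconnected_Ici.intermediate_value hr hs hcont ⟨hwr, hws⟩
      exact hne t ht ht0
    rcases hsign with hpos | hneg
    · refine h.not_eventually_ge hn hp hq hα ha hδ ?_
      filter_upwards [eventually_ge_atTop b] with r hr
      simpa [abs_of_pos (hpos r hr)] using (hb r hr).1
    · refine h.neg.not_eventually_ge hn hp hq hα ha hδ ?_
      filter_upwards [eventually_ge_atTop b] with r hr
      simpa [abs_of_neg (hneg r hr)] using (hb r hr).1

lemma eventually_snd_neg (h : IsDecaySystem n p q α a w u) (hp : 1 < p) (hα : 0 < α)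
    (hw : Tendsto w atTop (𝓝 0)) (hpos : ∀ᶠ r in atTop, 0 < w r) :
    ∀ᶠ r in atTop, u r < 0 := by
  obtain ⟨b, hb⟩ := eventually_atTop.1 (hpos.and (eventually_gt_atTop a))
  have hcross : ∀ r, b ≤ r → phiP p (u r) = 0 →
      -(n / r * phiP p (u r) + r * u r + (α * w r + |w r| ^ (q - 1) * w r)) < 0 := by
    intro r hr h0
    have hwr := (hb r hr).1
    rw [h0, phiP_eq_zero hp h0]
    have : 0 < α * w r + |w r| ^ (q - 1) * w r := by positivity
    linarith
  by_cases hex : ∃ c, b ≤ c ∧ phiP p (u c) ≤ 0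
  · obtain ⟨c, hbc, hc⟩ := hex
    have hle : ∀ r, c ≤ r → phiP p (u r) ≤ 0 := by
      intro r hr
      refine image_le_of_deriv_right_lt_deriv_boundary (f := fun s => phiP p (u s))
        (B := fun _ => 0) (B' := fun _ => 0) (a := c) (b := r)
        (fun s hs => (h.hasDerivAt_flux s (hb s (hbc.trans hs.1)).2).continuousAt.continuousWithinAt)
        (fun s hs => (h.hasDerivAt_flux s (hb s (hbc.trans hs.1)).2).hasDerivWithinAt)
        hc (fun s => hasDerivAt_const s 0) (fun s hs h0 => hcross s (hbc.trans hs.1) h0)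
        ⟨hr, le_rfl⟩
    filter_upwards [eventually_gt_atTop c] with r hr
    refine neg_of_phiP_neg (p := p) (lt_of_le_of_ne (hle r hr.le) fun h0 => ?_)
    have hmax : IsLocalMax (fun s => phiP p (u s)) r := by
      filter_upwards [lt_mem_nhds hr] with s hs
      rw [h0]
      exact hle s hs.le
    exact (hcross r (hbc.trans hr.le) h0).ne
      (hmax.hasDerivAt_eq_zero (h.hasDerivAt_flux r (hb r (hbc.trans hr.le)).2))
  · exfalso
    push Not at hex
    have hanti : AntitoneOn (fun r => -w r) (Ioi b) :=
      antitoneOn_Ioi_of_hasDerivAt_nonpos (fun r hr => (h.hasDerivAt_fst r (hb r hr.le).2).neg)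
        fun r hr => neg_nonpos.2 (pos_of_phiP_pos (hex r hr.le)).le
    have hge : w (b + 1) ≤ 0 := by
      refine ge_of_tendsto hw ?_
      filter_upwards [eventually_ge_atTop (b + 1)] with r hr
      exact neg_le_neg_iff.1 (hanti (show b + 1 ∈ Ioi b from lt_add_one b)
        (show r ∈ Ioi b from (lt_add_one b).trans_le hr) hr)
    exact absurd (hb (b + 1) (by linarith)).1 (not_lt.2 hge)

end IsDecaySystem

lemma IsSolutionOn.isDecaySystem {N : ℕ} {p q α a : ℝ} {w : ℝ → ℝ}
    (hw : IsSolutionOn N p q α w (Ici a)) :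
    IsDecaySystem ((N : ℝ) - 1) p q α a w (derivWithin w (Ici a)) where
  hasDerivAt_fst r hr :=
    ((hw.1.differentiableOn one_ne_zero r hr.le).hasDerivWithinAt).hasDerivAt (Ici_mem_nhds hr)
  hasDerivAt_flux r hr := by
    refine (((hw.2.1.differentiableOn one_ne_zero r hr.le).hasDerivWithinAt).hasDerivAt
      (Ici_mem_nhds hr)).congr_deriv ?_
    linarith [hw.2.2 r hr.le]

/-- Any solution of (E) on `[r₀,∞)`, `r₀ > 0`, satisfies `w(r) → 0` and `w'(r) → 0`
as `r → ∞`; moreover if `w > 0` for large `r` then `w' < 0` for large `r`. -/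
theorem stmt1 (N : ℕ) (hN : 1 ≤ N) (p q α : ℝ) (hp : 1 < p) (hq : 1 < q) (hα : 0 < α)
    (r₀ : ℝ) (hr₀ : 0 < r₀) (w : ℝ → ℝ) (hw : IsSolutionOn N p q α w (Ici r₀)) :
    Tendsto w atTop (𝓝 0) ∧
    Tendsto (fun r => derivWithin w (Ici r₀) r) atTop (𝓝 0) ∧
    ((∀ᶠ r in atTop, 0 < w r) → ∀ᶠ r in atTop, derivWithin w (Ici r₀) r < 0) := by
  have h := hw.isDecaySystem
  have hn : (0 : ℝ) ≤ (N : ℝ) - 1 := sub_nonneg.2 (by exact_mod_cast hN)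
  have hlim := h.tendsto_fst hn hp hq hα hr₀.le
  exact ⟨hlim, h.tendsto_snd hn hp hq hα hr₀.le, h.eventually_snd_neg hp hα hlim⟩
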